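/- arXiv:1712.03047 — 2 statements merged into one kernel-verified Lean document; each statement's English description precedes it below -/
import Mathlib

section
/- Let α ∈ (0,1) and φ₀ ∈ (0, π/2). The function G̃(z) = ∑_{n=0}^∞ α(n+1)(n+2) z^n / Γ(αn + 2α + 1) is entire, and G̃ is bounded on the closed sector {z ∈ ℂ : z ≠ 0, |arg(−z)| ≤ φ₀} ∪ {0}. -/
open Complex

/-- `G̃(z) = ∑ α(n+1)(n+2) z^n / Γ(αn+2α+1)`. -/
noncomputable def Gtilde (α : ℝ) (z : ℂ) : ℂ :=
  ∑' n : ℕ, (α * (n + 1) * (n + 2) : ℂ) * z ^ n / Complex.Gamma ((α : ℂ) * n + 2 * α + 1)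

open Filter Topology

/-- `cc n x = binom(n+x, n)`. -/
noncomputable def cc (n : ℕ) (x : ℝ) : ℝ := ∏ j ∈ Finset.range n, (1 + x / (j + 1))

lemma cc_zero (x : ℝ) : cc 0 x = 1 := by simp [cc]

lemma cc_at_zero (n : ℕ) : cc n 0 = 1 := by simp [cc]

lemma cc_succ (n : ℕ) (x : ℝ) : ((n : ℝ) + 1) * cc (n + 1) x = (n + 1 + x) * cc n x := by
  have : (n : ℝ) + 1 ≠ 0 := by positivity
  rw [cc, Finset.prod_range_succ, ← cc]
  field_simp

lemma cc_vandermonde (a b : ℝ) (n : ℕ) :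
    ∑ p ∈ Finset.HasAntidiagonal.antidiagonal n, cc p.1 a * cc p.2 b = cc n (a + b + 1) := by
  induction n with
  | zero => simp [cc_zero]
  | succ n ih =>
    have hn : (n : ℝ) + 1 ≠ 0 := by positivity
    apply mul_left_cancel₀ hn
    rw [cc_succ, ← ih]
    have h1 : ((n : ℝ) + 1) * ∑ p ∈ Finset.HasAntidiagonal.antidiagonal (n + 1), cc p.1 a * cc p.2 b
        = ∑ p ∈ Finset.HasAntidiagonal.antidiagonal (n + 1), ((p.1 : ℝ) * cc p.1 a) * cc p.2 b
          + ∑ p ∈ Finset.HasAntidiagonal.antidiagonal (n + 1), cc p.1 a * ((p.2 : ℝ) * cc p.2 b) := by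
      rw [Finset.mul_sum, ← Finset.sum_add_distrib]
      apply Finset.sum_congr rfl
      intro p hp
      have h : p.1 + p.2 = n + 1 := Finset.HasAntidiagonal.mem_antidiagonal.mp hp
      have h' : (p.1 : ℝ) + p.2 = n + 1 := by exact_mod_cast h
      rw [← h']; ring
    rw [h1, Finset.Nat.sum_antidiagonal_succ, Finset.Nat.sum_antidiagonal_succ']
    simp only [Nat.cast_zero, zero_mul, mul_zero, zero_add, Nat.cast_add, Nat.cast_one, add_zero]
    simp only [cc_succ]
    rw [← Finset.sum_add_distrib, Finset.mul_sum]
    apply Finset.sum_congr rfl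
    intro p hp
    have h : p.1 + p.2 = n := Finset.HasAntidiagonal.mem_antidiagonal.mp hp
    have h' : (p.1 : ℝ) + p.2 = n := by exact_mod_cast h
    rw [← h']; ring

lemma cc_nonneg (n : ℕ) (x : ℝ) (hx : -1 ≤ x) : 0 ≤ cc n x := by
  apply Finset.prod_nonneg
  intro j _
  have hj : (0 : ℝ) < j + 1 := by positivity
  have : 1 + x / ((j : ℝ) + 1) = (j + 1 + x) / (j + 1) := by field_simp
  rw [this]
  apply div_nonneg _ hj.le
  have : (0 : ℝ) ≤ j := by positivity
  linarith

lemma cc_le (n : ℕ) (x : ℝ) (hx : 0 ≤ x) : cc n x ≤ (1 + x) ^ n := by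
  calc cc n x ≤ ∏ j ∈ Finset.range n, (1 + x) := by
        apply Finset.prod_le_prod
        · intro j _; positivity
        · intro j _
          have : x / ((j : ℝ) + 1) ≤ x := div_le_self hx (by simp)
          linarith
    _ = _ := by simp

lemma ww_nonpos (n : ℕ) (α : ℝ) (h0 : 0 < α) (h1 : α < 1) : cc (n + 1) (-α - 1) ≤ 0 := by
  rw [cc, Finset.prod_range_succ']
  apply mul_nonpos_of_nonneg_of_nonpos
  · apply Finset.prod_nonneg
    intro j _
    have hj : (0 : ℝ) < ((j + 1 : ℕ) : ℝ) + 1 := by positivity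
    have : 1 + (-α - 1) / (((j + 1 : ℕ) : ℝ) + 1) = (j + 1 - α) / (((j + 1 : ℕ) : ℝ) + 1) := by
      field_simp; push_cast; ring
    rw [this]
    apply div_nonneg _ hj.le
    have : (0 : ℝ) ≤ j := by positivity
    linarith
  · norm_num; linarith

lemma summable_poly_geom (p : ℕ) (r : ℝ) (h0 : 0 ≤ r) (h1 : r < 1) :
    Summable (fun k : ℕ => ((k : ℝ) + 1) ^ p * r ^ k) := by
  rcases h0.eq_or_lt with rfl | hr
  · apply summable_of_ne_finset_zero (s := {0})
    intro b hb
    have : b ≠ 0 := by simpa using hb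
    simp [this]
  have := summable_pow_mul_geometric_of_norm_lt_one p (r := r) (by rwa [Real.norm_of_nonneg h0])
  have h2 := ((summable_nat_add_iff 1).mpr this).mul_right r⁻¹
  refine h2.congr fun k => ?_
  push_cast
  rw [pow_succ]
  field_simp

lemma cc_alpha_le (n k : ℕ) (α : ℝ) (h0 : 0 < α) (h1 : α < 1) :
    cc n (α * k) ≤ ((k : ℝ) + 1) ^ n := by
  refine (cc_le n _ (by positivity)).trans ?_
  apply pow_le_pow_left₀ (by positivity)
  have : α * k ≤ 1 * k := by gcongr
  linarith

noncomputable def uu (α : ℝ) (μ : ℂ) (n : ℕ) : ℂ := ∑' k : ℕ, (-μ) ^ k * (cc n (α * k) : ℂ)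

lemma uu_summable (α : ℝ) (h0 : 0 < α) (h1 : α < 1) (μ : ℂ) (hμ : ‖μ‖ < 1) (n : ℕ) :
    Summable (fun k : ℕ => (-μ) ^ k * (cc n (α * k) : ℂ)) := by
  apply Summable.of_norm_bounded (summable_poly_geom n ‖μ‖ (norm_nonneg _) hμ)
  intro k
  rw [norm_mul, norm_pow, norm_neg, Complex.norm_real,
    Real.norm_of_nonneg (cc_nonneg _ _ (by have : 0 ≤ α * k := by positivity
                                           linarith)), mul_comm]
  gcongr
  exact cc_alpha_le n k α h0 h1

lemma uu_rec (α : ℝ) (h0 : 0 < α) (h1 : α < 1) (μ : ℂ) (hμ : ‖μ‖ < 1) (n : ℕ) :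
    ∑ p ∈ Finset.HasAntidiagonal.antidiagonal n, (cc p.1 (-α - 1) : ℂ) * uu α μ p.2
      = (cc n (-α) : ℂ) - μ * uu α μ n := by
  have hs := fun m => uu_summable α h0 h1 μ hμ m
  have e1 : ∑ p ∈ Finset.HasAntidiagonal.antidiagonal n, (cc p.1 (-α - 1) : ℂ) * uu α μ p.2
      = ∑' k : ℕ, (-μ) ^ k * (cc n (α * k - α) : ℂ) := by
    simp only [uu, ← tsum_mul_left]
    have hex := Summable.tsum_finsetSum (s := Finset.HasAntidiagonal.antidiagonal n)
      (f := fun (p : ℕ × ℕ) (k : ℕ) =>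
        (cc p.1 (-α - 1) : ℂ) * ((-μ) ^ k * (cc p.2 (α * k) : ℂ)))
      (fun p _ => (hs p.2).mul_left (cc p.1 (-α - 1) : ℂ))
    refine hex.symm.trans ?_
    apply tsum_congr
    intro k
    have := cc_vandermonde (-α - 1) (α * k) n
    rw [show -α - 1 + α * k + 1 = α * k - α by ring] at this
    rw [← this]
    push_cast
    rw [Finset.mul_sum]
    apply Finset.sum_congr rfl
    intro p _
    ring
  have e2 : (fun k : ℕ => (-μ) ^ (k + 1) * (cc n (α * ((k + 1 : ℕ) : ℝ) - α) : ℂ))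
      = fun k : ℕ => -μ * ((-μ) ^ k * (cc n (α * k) : ℂ)) := by
    funext k
    rw [show α * ((k + 1 : ℕ) : ℝ) - α = α * k by push_cast; ring]
    ring
  have hs' : Summable (fun k : ℕ => (-μ) ^ k * (cc n (α * k - α) : ℂ)) := by
    rw [← summable_nat_add_iff 1, e2]
    exact (hs n).mul_left _
  rw [e1, hs'.tsum_eq_zero_add, e2, tsum_mul_left, ← uu]
  simp
  ring

lemma uu_bound (α : ℝ) (h0 : 0 < α) (h1 : α < 1) (μ : ℂ) (hμ : ‖μ‖ < 1) (hre : 0 ≤ μ.re) (n : ℕ) :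
    ‖uu α μ n‖ ≤ 1 := by
  have hone : 1 ≤ ‖1 + μ‖ := by
    refine le_trans ?_ (Complex.re_le_norm _)
    simpa using hre
  have key : ∀ m, ‖(1 + μ) * uu α μ m‖ ≤ 1 → ‖uu α μ m‖ ≤ 1 := by
    intro m h
    rw [norm_mul] at h
    nlinarith [norm_nonneg (uu α μ m)]
  induction n using Nat.strong_induction_on with
  | _ n ih =>
    apply key
    rcases n with _ | n
    · have := uu_rec α h0 h1 μ hμ 0
      simp [cc_zero] at this
      have h2 : (1 + μ) * uu α μ 0 = 1 := by linear_combination this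
      rw [h2]; simp
    · have h := uu_rec α h0 h1 μ hμ (n + 1)
      rw [Finset.Nat.sum_antidiagonal_succ, cc_zero] at h
      have h2 : (1 + μ) * uu α μ (n + 1) = (cc (n + 1) (-α) : ℂ) +
          ∑ p ∈ Finset.HasAntidiagonal.antidiagonal n, (-(cc (p.1 + 1) (-α - 1) : ℂ)) * uu α μ p.2 := by
        simp only [neg_mul, Finset.sum_neg_distrib]
        push_cast at h
        linear_combination h
      have hv := cc_vandermonde (-α - 1) 0 (n + 1)
      rw [Finset.Nat.sum_antidiagonal_succ, cc_zero] at hv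
      simp only [cc_at_zero, mul_one, add_zero, sub_add_cancel] at hv
      rw [h2]
      calc _ ≤ ‖(cc (n + 1) (-α) : ℂ)‖ +
          ∑ p ∈ Finset.HasAntidiagonal.antidiagonal n, ‖(-(cc (p.1 + 1) (-α - 1) : ℂ)) * uu α μ p.2‖ :=
            (norm_add_le _ _).trans (by gcongr; exact norm_sum_le _ _)
        _ ≤ cc (n + 1) (-α) + ∑ p ∈ Finset.HasAntidiagonal.antidiagonal n, -cc (p.1 + 1) (-α - 1) := by
            gcongr with p hp
            · rw [Complex.norm_real, Real.norm_of_nonneg (cc_nonneg _ _ (by linarith))]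
            · have hp' : p.1 + p.2 = n := Finset.HasAntidiagonal.mem_antidiagonal.mp hp
              have hb := ih p.2 (by omega)
              have hw := ww_nonpos p.1 α h0 h1
              rw [norm_mul, norm_neg, Complex.norm_real, Real.norm_of_nonpos hw]
              exact mul_le_of_le_one_right (by linarith) hb
        _ = 1 := by rw [Finset.sum_neg_distrib]; linarith

/-- the normalised coefficients -/
noncomputable def aa (n : ℕ) (x : ℝ) : ℝ := cc n x / (n : ℝ) ^ x

lemma aa_nonneg (n : ℕ) (x : ℝ) (hx : 0 ≤ x) : 0 ≤ aa n x :=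
  div_nonneg (cc_nonneg _ _ (by linarith)) (by positivity)

lemma aa_succ_le (n : ℕ) (hn : 1 ≤ n) (x : ℝ) (hx : 0 ≤ x) : aa (n + 1) x ≤ aa n x := by
  have hn' : (0 : ℝ) < n := by exact_mod_cast hn
  have hc := cc_nonneg n x (by linarith)
  have h1 : cc (n + 1) x = cc n x * (1 + x / (n + 1)) := by
    rw [cc, Finset.prod_range_succ, ← cc]
  have h2 : (1 + x / ((n : ℝ) + 1)) ≤ (((n : ℝ) + 1) / n) ^ x := by
    have hlog : 1 / ((n : ℝ) + 1) ≤ Real.log (((n : ℝ) + 1) / n) := by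
      have := Real.one_sub_inv_le_log_of_pos (x := ((n : ℝ) + 1) / n) (by positivity)
      refine le_trans (le_of_eq ?_) this
      field_simp
      ring
    rw [Real.rpow_def_of_pos (by positivity)]
    have h3 := Real.add_one_le_exp (x / ((n : ℝ) + 1))
    have h4 : x / ((n : ℝ) + 1) ≤ Real.log (((n : ℝ) + 1) / n) * x := by
      calc x / ((n : ℝ) + 1) = 1 / ((n : ℝ) + 1) * x := by ring
        _ ≤ _ := by gcongr
    have h5 := Real.exp_le_exp.mpr h4
    linarith
  rw [Real.div_rpow (by positivity) hn'.le] at h2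
  have p1 : 0 < (n : ℝ) ^ x := Real.rpow_pos_of_pos hn' _
  have p2 : 0 < ((n : ℝ) + 1) ^ x := Real.rpow_pos_of_pos (by positivity) _
  rw [aa, aa, h1]
  push_cast
  rw [div_le_div_iff₀ p2 p1]
  rw [le_div_iff₀ p1] at h2
  rw [mul_assoc]
  gcongr

lemma aa_le (N n : ℕ) (hN : 1 ≤ N) (h : N ≤ n) (x : ℝ) (hx : 0 ≤ x) : aa n x ≤ aa N x := by
  induction n, h using Nat.le_induction with
  | base => rfl
  | succ n hn ih => exact (aa_succ_le n (hN.trans hn) x hx).trans ih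

lemma aa_tendsto (x : ℝ) (hx : 0 ≤ x) :
    Tendsto (fun n => aa n x) atTop (𝓝 (1 / Real.Gamma (x + 1))) := by
  rcases hx.eq_or_lt with rfl | hx
  · simp [aa, cc_at_zero]
  have h := Real.GammaSeq_tendsto_Gamma x
  have hG : Real.Gamma x ≠ 0 := (Real.Gamma_pos_of_pos hx).ne'
  have h2 := (h.const_mul x).inv₀ (mul_ne_zero hx.ne' hG)
  rw [Real.Gamma_add_one hx.ne', one_div]
  refine h2.congr fun n => ?_
  have hf : (n.factorial : ℝ) ≠ 0 := by positivity
  have hcc : cc n x * n.factorial = ∏ j ∈ Finset.range n, (x + ((j : ℝ) + 1)) := by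
    rw [← Finset.prod_range_add_one_eq_factorial]
    push_cast
    rw [cc, ← Finset.prod_mul_distrib]
    apply Finset.prod_congr rfl
    intro j _
    have : (j : ℝ) + 1 ≠ 0 := by positivity
    field_simp
    ring
  rw [Real.GammaSeq, Finset.prod_range_succ', aa]
  push_cast
  rw [← hcc]
  simp only [add_zero]
  have hcp : cc n x ≠ 0 := by
    apply Finset.prod_ne_zero_iff.mpr
    intro j _
    positivity
  by_cases hn : (n : ℝ) ^ x = 0
  · simp [hn]
  field_simp

lemma inv_Gamma_le (N : ℕ) (hN : 1 ≤ N) (x : ℝ) (hx : 0 ≤ x) :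
    1 / Real.Gamma (x + 1) ≤ aa N x :=
  le_of_tendsto (aa_tendsto x hx)
    (eventually_atTop.mpr ⟨N, fun n hn => aa_le N n hN hn x hx⟩)

lemma aa_alpha_le (N k : ℕ) (α : ℝ) (h0 : 0 < α) (h1 : α < 1) :
    aa N (α * k) ≤ ((k : ℝ) + 1) ^ N * (((N : ℝ) ^ α)⁻¹) ^ k := by
  rw [aa, Real.rpow_mul (by positivity), Real.rpow_natCast, inv_pow, ← div_eq_mul_inv]
  gcongr
  exact cc_alpha_le N k α h0 h1

lemma exists_N (α : ℝ) (h0 : 0 < α) (R : ℝ) :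
    ∃ N : ℕ, 1 ≤ N ∧ ∀ n, N ≤ n → R < (n : ℝ) ^ α := by
  have h := (tendsto_rpow_atTop h0).comp (tendsto_natCast_atTop_atTop (R := ℝ))
  obtain ⟨N, hN⟩ := eventually_atTop.mp (h.eventually_gt_atTop R)
  exact ⟨max N 1, le_max_right _ _, fun n hn => hN n ((le_max_left _ _).trans hn)⟩

lemma summable_dom (α : ℝ) (h0 : 0 < α) (h1 : α < 1) (p : ℕ) (R : ℝ) (hR : 0 ≤ R) (N : ℕ)
    (hN1 : 1 ≤ N) (hN : R < (N : ℝ) ^ α) :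
    Summable (fun k : ℕ => ((k : ℝ) + 1) ^ p * R ^ k * aa N (α * k)) := by
  have hp : 0 < (N : ℝ) ^ α := lt_of_le_of_lt hR hN
  have h := summable_poly_geom (p + N) (R * ((N : ℝ) ^ α)⁻¹) (by positivity)
    (by rw [← div_eq_mul_inv]; exact (div_lt_one hp).mpr hN)
  refine Summable.of_nonneg_of_le (fun k => ?_) (fun k => ?_) h
  · have := aa_nonneg N (α * k) (by positivity)
    positivity
  · calc _ ≤ ((k : ℝ) + 1) ^ p * R ^ k * (((k : ℝ) + 1) ^ N * (((N : ℝ) ^ α)⁻¹) ^ k) := by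
          gcongr
          exact aa_alpha_le N k α h0 h1
      _ = _ := by rw [mul_pow, pow_add]; ring

lemma summable_ml (α : ℝ) (h0 : 0 < α) (h1 : α < 1) (p : ℕ) (R : ℝ) (hR : 0 ≤ R) :
    Summable (fun k : ℕ => ((k : ℝ) + 1) ^ p * R ^ k * (1 / Real.Gamma (α * k + 1))) := by
  obtain ⟨N, hN1, hN⟩ := exists_N α h0 R
  refine Summable.of_nonneg_of_le (fun k => ?_) (fun k => ?_)
    (summable_dom α h0 h1 p R hR N hN1 (hN N le_rfl))
  · have := Real.Gamma_pos_of_pos (s := α * k + 1) (by positivity)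
    positivity
  · gcongr
    exact inv_Gamma_le N hN1 _ (by positivity)

/-- Mittag-Leffler function -/
noncomputable def ML (α : ℝ) (z : ℂ) : ℂ := ∑' k : ℕ, z ^ k * ((1 / Real.Gamma (α * k + 1) : ℝ) : ℂ)

lemma ML_bound (α : ℝ) (h0 : 0 < α) (h1 : α < 1) (z : ℂ) (hz : z.re ≤ 0) : ‖ML α z‖ ≤ 1 := by
  obtain ⟨N, hN1, hN⟩ := exists_N α h0 ‖z‖
  have ht : Tendsto (fun n : ℕ => ∑' k : ℕ, z ^ k * (aa n (α * k) : ℂ)) atTop (𝓝 (ML α z)) := by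
    apply tendsto_tsum_of_dominated_convergence
      (summable_dom α h0 h1 0 ‖z‖ (norm_nonneg _) N hN1 (hN N le_rfl))
    · intro k
      apply Tendsto.const_mul
      exact (Complex.continuous_ofReal.tendsto _).comp (aa_tendsto (α * k) (by positivity))
    · filter_upwards [eventually_ge_atTop N] with n hn k
      rw [norm_mul, norm_pow, Complex.norm_real,
        Real.norm_of_nonneg (aa_nonneg n _ (by positivity)), pow_zero, one_mul]
      gcongr
      exact aa_le N n hN1 hn _ (by positivity)
  refine le_of_tendsto ht.norm ?_
  filter_upwards [eventually_ge_atTop N] with n hn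
  have hn' := hN n hn
  have hp : 0 < (n : ℝ) ^ α := lt_of_le_of_lt (norm_nonneg _) hn'
  have hu := uu_bound α h0 h1 (-z * (((n : ℝ) ^ α)⁻¹ : ℝ)) (by
    rw [norm_mul, norm_neg, Complex.norm_real, Real.norm_of_nonneg (by positivity),
      ← div_eq_mul_inv]
    exact (div_lt_one hp).mpr hn') (by
    rw [Complex.re_mul_ofReal]
    exact mul_nonneg (by simpa using hz) (by positivity)) n
  refine le_trans (le_of_eq (congrArg norm ?_)) hu
  unfold uu
  apply tsum_congr
  intro k
  rw [aa, Real.rpow_mul (by positivity), Real.rpow_natCast]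
  push_cast
  rw [neg_mul, neg_neg, mul_pow, inv_pow]
  ring

lemma ML_deriv_aux (α : ℝ) (h0 : 0 < α) (h1 : α < 1) (f : ℕ → ℂ → ℂ) (hf : ∀ k, Differentiable ℂ (f k))
    (p : ℕ) (hb : ∀ k (z : ℂ) (R : ℝ), 1 ≤ R → ‖z‖ ≤ R →
      ‖f k z‖ ≤ ((k : ℝ) + 1) ^ p * R ^ k * (1 / Real.Gamma (α * k + 1))) :
    Differentiable ℂ (fun z => ∑' k, f k z) ∧
      ∀ z, deriv (fun z => ∑' k, f k z) z = ∑' k, deriv (f k) z := by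
  have hU : ∀ z : ℂ, z ∈ Metric.ball (0 : ℂ) (‖z‖ + 1) := by intro z; simp
  have hbd : ∀ z : ℂ, ∀ k w, w ∈ Metric.ball (0 : ℂ) (‖z‖ + 1) → ‖f k w‖ ≤
      ((k : ℝ) + 1) ^ p * (‖z‖ + 1) ^ k * (1 / Real.Gamma (α * k + 1)) := by
    intro z k w hw
    exact hb k w _ (by linarith [norm_nonneg z]) (by simpa using (mem_ball_zero_iff.mp hw).le)
  refine ⟨fun z => ?_, fun z => ?_⟩
  · exact (differentiableOn_tsum_of_summable_norm (summable_ml α h0 h1 p (‖z‖ + 1) (by positivity))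
      (fun k => (hf k).differentiableOn) Metric.isOpen_ball (hbd z)).differentiableAt
      (Metric.isOpen_ball.mem_nhds (hU z))
  · exact (hasSum_deriv_of_summable_norm (summable_ml α h0 h1 p (‖z‖ + 1) (by positivity))
      (fun k => (hf k).differentiableOn) Metric.isOpen_ball (hbd z) (hU z)).tsum_eq.symm

lemma ML_deriv2 (α : ℝ) (h0 : 0 < α) (h1 : α < 1) :
    Differentiable ℂ (ML α) ∧ Differentiable ℂ (deriv (ML α)) ∧
      ∀ z, Gtilde α z = α * deriv (deriv (ML α)) z := by
  have hG : ∀ k : ℕ, 0 < Real.Gamma (α * k + 1) := fun k =>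
    Real.Gamma_pos_of_pos (by positivity)
  obtain ⟨d1, e1⟩ := ML_deriv_aux α h0 h1
    (fun k z => z ^ k * ((1 / Real.Gamma (α * k + 1) : ℝ) : ℂ)) (fun k => by fun_prop) 0 (by
      intro k z R hR hz
      have := hG k
      rw [norm_mul, norm_pow, Complex.norm_real, Real.norm_of_nonneg (by positivity), pow_zero,
        one_mul]
      gcongr)
  have e1' : deriv (ML α) = fun z => ∑' k : ℕ,
      (k : ℂ) * z ^ (k - 1) * ((1 / Real.Gamma (α * k + 1) : ℝ) : ℂ) := by
    funext z
    rw [show ML α = fun z => ∑' k : ℕ, z ^ k * ((1 / Real.Gamma (α * k + 1) : ℝ) : ℂ) from rfl, e1 z]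
    apply tsum_congr
    intro k
    simp only [deriv_mul_const_field, deriv_pow_field]
  obtain ⟨d2, e2⟩ := ML_deriv_aux α h0 h1
    (fun k z => (k : ℂ) * z ^ (k - 1) * ((1 / Real.Gamma (α * k + 1) : ℝ) : ℂ))
    (fun k => by fun_prop) 1 (by
      intro k z R hR hz
      have := hG k
      rw [norm_mul, norm_mul, norm_pow, Complex.norm_real, Real.norm_of_nonneg (by positivity),
        pow_one, Complex.norm_natCast]
      gcongr
      · linarith
      · exact (pow_le_pow_left₀ (norm_nonneg _) hz _).trans (pow_le_pow_right₀ hR (by omega)))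
  refine ⟨d1, by rw [e1']; exact d2, fun z => ?_⟩
  rw [e1', e2 z]
  have e3 : ∀ k : ℕ, deriv (fun z : ℂ => (k : ℂ) * z ^ (k - 1) *
      ((1 / Real.Gamma (α * k + 1) : ℝ) : ℂ)) z =
      (k : ℂ) * ((k - 1 : ℕ) * z ^ (k - 1 - 1)) * ((1 / Real.Gamma (α * k + 1) : ℝ) : ℂ) := by
    intro k
    rw [deriv_mul_const_field, deriv_const_mul_field, deriv_pow_field]
  simp only [e3]
  rw [Gtilde, ← tsum_mul_left]
  rw [← (add_left_injective 2).tsum_eq (f := fun k : ℕ => (α : ℂ) *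
    ((k : ℂ) * ((k - 1 : ℕ) * z ^ (k - 1 - 1)) * ((1 / Real.Gamma (α * k + 1) : ℝ) : ℂ)))]
  · apply tsum_congr
    intro n
    have : (α : ℂ) * n + 2 * α + 1 = ((α * ((n + 2 : ℕ) : ℝ) + 1 : ℝ) : ℂ) := by
      push_cast; ring
    rw [this, Complex.Gamma_ofReal]
    simp only [Nat.add_sub_cancel, show n + 2 - 1 = n + 1 by omega]
    push_cast
    ring
  · intro k hk
    rcases k with _ | _ | k
    · simp at hk
    · simp at hk
    · exact ⟨k, rfl⟩

theorem Gtilde_entire_and_bounded_on_sector (α φ₀ : ℝ) (h0 : 0 < α) (h1 : α < 1)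
    (hφ0 : 0 < φ₀) (hφ1 : φ₀ < Real.pi / 2) :
    Differentiable ℂ (Gtilde α) ∧
    ∃ M : ℝ, ∀ z : ℂ, (z = 0 ∨ (z ≠ 0 ∧ |Complex.arg (-z)| ≤ φ₀)) → ‖Gtilde α z‖ ≤ M := by
  obtain ⟨d1, d2, e⟩ := ML_deriv2 α h0 h1
  have d3 : Differentiable ℂ (deriv (deriv (ML α))) := by
    intro z
    exact (d2.analyticAt z).deriv.differentiableAt
  have hd : Differentiable ℂ (Gtilde α) := by
    rw [show Gtilde α = fun z => α * deriv (deriv (ML α)) z from funext e]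
    exact d3.const_mul _
  refine ⟨hd, ?_⟩
  obtain ⟨M₁, hM₁⟩ := (isCompact_closedBall (0 : ℂ) 1).exists_bound_of_continuousOn
    hd.continuous.continuousOn
  set c := Real.cos φ₀ with hc
  have hcpos : 0 < c := Real.cos_pos_of_mem_Ioo ⟨by linarith, hφ1⟩
  refine ⟨max M₁ (α * (2 / c ^ 2)), fun z hz => ?_⟩
  by_cases hz1 : ‖z‖ ≤ 1
  · exact (hM₁ z (by simpa using hz1)).trans (le_max_left _ _)
  push Not at hz1
  refine le_trans ?_ (le_max_right _ _)
  have hz0 : z ≠ 0 := by rintro rfl; simp at hz1; linarith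
  have harg : |Complex.arg (-z)| ≤ φ₀ := by
    rcases hz with h | h
    · exact absurd h hz0
    · exact h.2
  have hre : z.re ≤ -c := by
    have h2 : c ≤ Real.cos (Complex.arg (-z)) := by
      rw [← Real.cos_abs (Complex.arg (-z))]
      exact Real.cos_le_cos_of_nonneg_of_le_pi (abs_nonneg _) (by linarith [Real.pi_pos]) harg
    have h3 := Complex.norm_mul_cos_arg (-z)
    rw [norm_neg, Complex.neg_re] at h3
    nlinarith
  have hcau := Complex.norm_iteratedDeriv_le_of_forall_mem_sphere_norm_le (c := z) (R := c) (C := 1)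
    (f := ML α) 2 hcpos d1.diffContOnCl (by
      intro w hw
      apply ML_bound α h0 h1
      have h4 : (w - z).re ≤ c := (Complex.re_le_norm _).trans (by
        rw [mem_sphere_iff_norm] at hw; exact hw.le)
      rw [Complex.sub_re] at h4
      linarith)
  rw [iteratedDeriv_succ, iteratedDeriv_one] at hcau
  rw [e z, norm_mul, Complex.norm_real, Real.norm_of_nonneg h0.le]
  gcongr
  simpa using hcau
end

section
/- Let α ∈ (0,1), φ₀ ∈ (0, π/2), and λ ∈ ℂ with |arg(−λ)| ≤ φ₀, λ ≠ 0. Define g(s) = α λ E_α'(λ s^α) for s > 0, where E_α is the Mittag–Leffler function. Then there is a constant C = C(α, φ₀) such that for all 0 < s, s' ≤ T, |g(s) − g(s')| ≤ C |λ|² |s^α − (s')^α|. -/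
open Complex

/-- The Mittag–Leffler function `E_α(z) = ∑ z^n / Γ(αn+1)` as an entire function of `z ∈ ℂ`. -/
noncomputable def mittagLefflerC (α : ℝ) (z : ℂ) : ℂ :=
  ∑' n : ℕ, z ^ n / Complex.Gamma ((α : ℂ) * n + 1)

/-- Coefficients of `(1 - ζ)^(-x)`. -/
noncomputable def pc (n : ℕ) (x : ℝ) : ℝ := (-1) ^ n * Ring.choose (-x) n

lemma pc_zero (x : ℝ) : pc 0 x = 1 := by simp [pc]

lemma pc_succ (n : ℕ) (x : ℝ) : pc (n + 1) x = pc n x * ((x + n) / (n + 1)) := by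
  have hf : (n.factorial : ℝ) ≠ 0 := by exact_mod_cast n.factorial_ne_zero
  have hn : (n : ℝ) + 1 ≠ 0 := by positivity
  simp only [pc, Ring.choose_eq_smul, descPochhammer_succ_right, Polynomial.smeval_mul,
    Polynomial.smeval_sub, Polynomial.smeval_X, Polynomial.smeval_natCast, Nat.factorial_succ,
    smul_eq_mul]
  push_cast
  field_simp
  simp
  ring

lemma pc_one (n : ℕ) : pc n 1 = 1 := by
  induction n with
  | zero => exact pc_zero 1
  | succ n ih =>
    have hn : (n : ℝ) + 1 ≠ 0 := by positivity
    rw [pc_succ, ih, add_comm (1 : ℝ), div_self hn, one_mul]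

lemma pc_nonneg (n : ℕ) {x : ℝ} (hx : 0 ≤ x) : 0 ≤ pc n x := by
  induction n with
  | zero => simp [pc_zero]
  | succ n ih => rw [pc_succ]; positivity

lemma pc_add (n : ℕ) (x y : ℝ) :
    pc n (x + y) = ∑ ij ∈ Finset.HasAntidiagonal.antidiagonal n, pc ij.1 x * pc ij.2 y := by
  unfold pc
  rw [neg_add, Ring.add_choose_eq n (Commute.all _ _), Finset.mul_sum]
  refine Finset.sum_congr rfl fun ij hij => ?_
  rw [← Finset.HasAntidiagonal.mem_antidiagonal.1 hij, pow_add]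
  ring

lemma pc_neg_nonpos (n : ℕ) {a : ℝ} (h0 : 0 < a) (h1 : a < 1) : pc (n + 1) (-a) ≤ 0 := by
  induction n with
  | zero => rw [pc_succ]; simp [pc_zero]; linarith
  | succ n ih =>
    rw [pc_succ]
    refine mul_nonpos_of_nonpos_of_nonneg ih ?_
    push_cast
    apply div_nonneg <;> [linarith [(Nat.cast_nonneg n : (0 : ℝ) ≤ n)]; positivity]

lemma pc_hasSum (x r : ℝ) (hr0 : 0 ≤ r) (hr1 : r < 1) :
    HasSum (fun n => pc n x * r ^ n) ((1 - r) ^ (-x)) := by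
  have h := (Real.one_add_rpow_hasFPowerSeriesOnBall_zero (a := -x)).hasSum (y := -r) (by
    simp [enorm_eq_nnnorm]
    rw [← NNReal.coe_lt_coe]; simpa [abs_of_nonneg hr0] using hr1)
  rw [zero_add, ← sub_eq_add_neg] at h
  have e : (fun n => pc n x * r ^ n) = fun n => (binomialSeries ℝ (-x) n) fun _ => -r := by
    funext n
    rw [binomialSeries_apply]
    simp [pc, neg_pow r]
    ring
  rw [e]
  exact h

lemma pc_bound (n : ℕ) {x r : ℝ} (hx : 0 ≤ x) (hr0 : 0 < r) (hr1 : r < 1) :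
    pc n (x + 1) ≤ (r ^ n)⁻¹ * (1 - r) ^ (-x) := by
  rw [inv_mul_eq_div, le_div_iff₀ (by positivity), pc_add]
  have h := pc_hasSum x r hr0.le hr1
  rw [Finset.Nat.sum_antidiagonal_eq_sum_range_succ_mk, Finset.sum_mul, ← h.tsum_eq]
  refine le_trans ?_ (h.summable.sum_le_tsum (Finset.range n.succ)
    (fun i _ => mul_nonneg (pc_nonneg i hx) (by positivity)))
  refine Finset.sum_le_sum fun i hi => ?_
  rw [pc_one, mul_one]
  exact mul_le_mul_of_nonneg_left
    (pow_le_pow_of_le_one hr0.le hr1.le (Nat.lt_succ_iff.1 (Finset.mem_range.1 hi)))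
    (pc_nonneg i hx)

lemma pc_eq_prod (n : ℕ) (x : ℝ) :
    pc n x * n.factorial = ∏ j ∈ Finset.range n, (x + j) := by
  induction n with
  | zero => simp [pc_zero]
  | succ n ih =>
    have hn : (n : ℝ) + 1 ≠ 0 := by positivity
    rw [Finset.prod_range_succ, ← ih, pc_succ, Nat.factorial_succ]
    push_cast
    field_simp

open Filter Topology in
lemma pc_tendsto {x : ℝ} (hx : 0 ≤ x) :
    Tendsto (fun n : ℕ => pc n (x + 1) * (n : ℝ) ^ (-x)) atTop (𝓝 (Real.Gamma (x + 1))⁻¹) := by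
  have h1 := (Real.GammaSeq_tendsto_Gamma (x + 1)).inv₀ (Real.Gamma_pos_of_pos (by linarith)).ne'
  have h2 : Tendsto (fun n : ℕ => (n : ℝ) / (n + (x + 1))) atTop (𝓝 1) :=
    tendsto_natCast_div_add_atTop (x + 1)
  have h3 := h1.mul h2
  rw [mul_one] at h3
  refine h3.congr' ?_
  filter_upwards [eventually_gt_atTop 0] with n hn
  have hn' : (0 : ℝ) < n := by exact_mod_cast hn
  have hf : (n.factorial : ℝ) ≠ 0 := by exact_mod_cast n.factorial_ne_zero
  rw [Real.GammaSeq, Finset.prod_range_succ, ← pc_eq_prod, Real.rpow_add_one hn'.ne',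
    Real.rpow_neg hn'.le]
  have h4 : (n : ℝ) ^ x ≠ 0 := by positivity
  have h5 : x + 1 + (n : ℝ) ≠ 0 := by positivity
  have h6 : (n : ℝ) + (x + 1) ≠ 0 := by positivity
  field_simp
  ring

/-- the bound with `r = 1 - A / n` -/
lemma pc_scaled {A x : ℝ} (hA : 0 < A) (hx : 0 ≤ x) (m n : ℕ) (hn : A < n) :
    pc m (x + 1) * (n : ℝ) ^ (-x) ≤ ((1 - A / n) ^ m)⁻¹ * A ^ (-x) := by
  have hn' : (0 : ℝ) < n := hA.trans hn
  have h := pc_bound m hx (r := 1 - A / n) (by rw [sub_pos, div_lt_one hn']; exact hn)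
    (by have : 0 < A / n := by positivity
        linarith)
  rw [sub_sub_cancel, Real.div_rpow hA.le hn'.le] at h
  have hp : (0 : ℝ) < (n : ℝ) ^ (-x) := by positivity
  calc _ ≤ _ := mul_le_mul_of_nonneg_right h hp.le
    _ = _ := by field_simp

lemma exp_bound {A : ℝ} (hA : 0 < A) (n : ℕ) (hn : 2 * A ≤ n) :
    ((1 - A / n) ^ n)⁻¹ ≤ Real.exp (2 * A) := by
  have hn' : (0 : ℝ) < n := by linarith
  have h1 : 0 < 1 - A / n := by rw [sub_pos, div_lt_one hn']; linarith
  have h2 : A / n ≤ 1 / 2 := by rw [div_le_iff₀ hn']; linarith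
  have h3 : (1 - A / n)⁻¹ ≤ Real.exp (2 * (A / n)) := by
    refine le_trans ?_ (Real.add_one_le_exp _)
    rw [inv_le_iff_one_le_mul₀ h1]
    have : 0 < A / n := by positivity
    nlinarith
  rw [← inv_pow]
  calc _ ≤ (Real.exp (2 * (A / n))) ^ n := pow_le_pow_left₀ (by positivity) h3 n
    _ = _ := by rw [← Real.exp_nat_mul]; congr 1; field_simp

lemma pc_dom {A x : ℝ} (hA : 0 < A) (hx : 0 ≤ x) (n : ℕ) (hn : 2 * A ≤ n) :
    pc n (x + 1) * (n : ℝ) ^ (-x) ≤ Real.exp (2 * A) * A ^ (-x) :=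
  (pc_scaled hA hx n n (by linarith)).trans
    (mul_le_mul_of_nonneg_right (exp_bound hA n hn) (by positivity))

lemma gamma_inv_bound {A x : ℝ} (hA : 0 < A) (hx : 0 ≤ x) :
    (Real.Gamma (x + 1))⁻¹ ≤ Real.exp (2 * A) * A ^ (-x) := by
  refine le_of_tendsto (pc_tendsto hx) ?_
  filter_upwards [Filter.eventually_ge_atTop ⌈2 * A⌉₊] with n hn
  exact pc_dom hA hx n (Nat.ceil_le.1 hn)

/-- The discrete scheme is contractive. -/
lemma scheme_bound {a : ℝ} (h0 : 0 < a) (h1 : a < 1) {μ : ℂ} (hμ : μ.re ≤ 0)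
    (hs : ∀ m, Summable fun k : ℕ => μ ^ k * (pc m (a * k + 1) : ℂ)) (m : ℕ) :
    ‖∑' k : ℕ, μ ^ k * (pc m (a * k + 1) : ℂ)‖ ≤ 1 := by
  set U : ℕ → ℂ := fun m => ∑' k : ℕ, μ ^ k * (pc m (a * k + 1) : ℂ) with hU
  change ‖U m‖ ≤ 1
  have key : ∀ m, ∑ j ∈ Finset.range (m + 1), (pc j (-a) : ℂ) * U (m - j)
      = (pc m (1 - a) : ℂ) + μ * U m := by
    intro m
    have e1 : ∑ j ∈ Finset.range (m + 1), (pc j (-a) : ℂ) * U (m - j)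
        = ∑' k : ℕ, μ ^ k * (pc m (-a + (a * k + 1)) : ℂ) := by
      simp only [hU, ← tsum_mul_left]
      rw [← Summable.tsum_finsetSum (fun j _ => (hs (m - j)).mul_left _)]
      refine tsum_congr fun k => ?_
      rw [pc_add, Finset.Nat.sum_antidiagonal_eq_sum_range_succ_mk]
      push_cast
      rw [Finset.mul_sum]
      exact Finset.sum_congr rfl fun j _ => by ring
    have e2 : (fun k : ℕ => μ ^ (k + 1) * (pc m (-a + (a * (k + 1 : ℕ) + 1)) : ℂ))
        = fun k : ℕ => μ * (μ ^ k * (pc m (a * k + 1) : ℂ)) := by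
      funext k
      rw [show -a + (a * ((k + 1 : ℕ) : ℝ) + 1) = a * k + 1 by push_cast; ring]
      ring
    have e3 : Summable (fun k : ℕ => μ ^ k * (pc m (-a + (a * k + 1)) : ℂ)) := by
      rw [← summable_nat_add_iff 1, e2]
      exact (hs m).mul_left μ
    rw [e1, e3.tsum_eq_zero_add, e2, tsum_mul_left]
    simp only [hU]
    congr 2
    rw [pow_zero, one_mul]
    congr 2
    push_cast
    ring
  have sum1 : ∀ m, ∑ j ∈ Finset.range (m + 1), pc j (-a) = pc m (1 - a) := by
    intro m
    rw [show 1 - a = -a + 1 by ring, pc_add, Finset.Nat.sum_antidiagonal_eq_sum_range_succ_mk]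
    exact Finset.sum_congr rfl fun j _ => by rw [pc_one, mul_one]
  have hμ1 : 1 ≤ ‖1 - μ‖ := by
    refine le_trans ?_ (Complex.re_le_norm _)
    simp; exact hμ
  induction m using Nat.strong_induction_on with
  | _ m ih =>
    have k1 := key m
    have s1 := sum1 m
    rw [Finset.sum_range_succ', pc_zero] at k1 s1
    have k2 : (1 - μ) * U m = (pc m (1 - a) : ℂ)
        + ∑ j ∈ Finset.range m, ((-pc (j + 1) (-a) : ℝ) : ℂ) * U (m - (j + 1)) := by
      have : ∑ j ∈ Finset.range m, ((-pc (j + 1) (-a) : ℝ) : ℂ) * U (m - (j + 1))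
        = - ∑ j ∈ Finset.range m, (pc (j + 1) (-a) : ℂ) * U (m - (j + 1)) := by
        rw [← Finset.sum_neg_distrib]
        exact Finset.sum_congr rfl fun j _ => by push_cast; ring
      rw [this]
      simp only [Nat.sub_zero, ofReal_one, one_mul] at k1
      linear_combination k1
    have k3 : ‖(1 - μ) * U m‖ ≤ 1 := by
      rw [k2]
      calc _ ≤ pc m (1 - a) + ∑ j ∈ Finset.range m, (-pc (j + 1) (-a)) := by
            refine (norm_add_le _ _).trans (add_le_add ?_ ?_)
            · rw [Complex.norm_real, Real.norm_of_nonneg (pc_nonneg m (by linarith))]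
            · refine norm_sum_le_of_le _ fun j hj => ?_
              have hj' := Finset.mem_range.1 hj
              have hp : 0 ≤ -pc (j + 1) (-a) := neg_nonneg.2 (pc_neg_nonpos j h0 h1)
              rw [norm_mul, Complex.norm_real, Real.norm_of_nonneg hp]
              exact mul_le_of_le_one_right hp (ih _ (by omega))
        _ = 1 := by rw [Finset.sum_neg_distrib]; linarith
    rw [norm_mul] at k3
    nlinarith [norm_nonneg (U m)]

lemma term_eq (a : ℝ) (z : ℂ) (k : ℕ) :
    z ^ k / Complex.Gamma ((a : ℂ) * k + 1) = z ^ k * ((Real.Gamma (a * k + 1))⁻¹ : ℝ) := by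
  rw [div_eq_mul_inv, Complex.ofReal_inv, ← Complex.Gamma_ofReal]
  push_cast
  rfl

lemma exists_A {a : ℝ} (h0 : 0 < a) {R : ℝ} (hR : 0 ≤ R) :
    ∃ A : ℝ, 0 < A ∧ ∀ k : ℕ, A ^ (-(a * k)) = ((2 * (R + 1)) ^ k)⁻¹ := by
  have hp : 0 < 2 * (R + 1) := by positivity
  refine ⟨(2 * (R + 1)) ^ (1 / a), by positivity, fun k => ?_⟩
  rw [← Real.rpow_mul hp.le, ← Real.rpow_natCast, ← Real.rpow_neg hp.le]
  congr 1
  field_simp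

lemma geom_bound {R : ℝ} (hR : 0 ≤ R) (k : ℕ) :
    R ^ k * ((2 * (R + 1)) ^ k)⁻¹ ≤ (1 / 2) ^ k := by
  rw [← inv_pow, ← mul_pow]
  refine pow_le_pow_left₀ (by positivity) ?_ k
  rw [← div_eq_mul_inv, div_le_div_iff₀ (by positivity) (by positivity)]
  linarith

lemma geom_summable (c : ℝ) : Summable fun k : ℕ => c * (1 / 2 : ℝ) ^ k :=
  (summable_geometric_of_lt_one (by norm_num) (by norm_num)).mul_left c

lemma ml_differentiable {a : ℝ} (h0 : 0 < a) : Differentiable ℂ (mittagLefflerC a) := by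
  intro z
  set R := ‖z‖ + 1 with hR
  have hR0 : 0 ≤ R := by positivity
  obtain ⟨A, hA, hAk⟩ := exists_A h0 hR0
  have h : DifferentiableOn ℂ (mittagLefflerC a) (Metric.ball 0 R) := by
    refine Complex.differentiableOn_tsum_of_summable_norm (geom_summable (Real.exp (2 * A)))
      (fun k => by fun_prop) Metric.isOpen_ball (fun k w hw => ?_)
    have hx : 0 ≤ a * k := by positivity
    have hg := gamma_inv_bound hA hx
    rw [hAk] at hg
    have hgp : 0 ≤ (Real.Gamma (a * k + 1))⁻¹ :=
      inv_nonneg.2 (Real.Gamma_pos_of_pos (by linarith)).le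
    have hw' : ‖w‖ ≤ R := by simpa using (mem_ball_zero_iff.1 hw).le
    rw [term_eq, norm_mul, norm_pow, Complex.norm_real, Real.norm_of_nonneg hgp]
    calc _ ≤ R ^ k * (Real.exp (2 * A) * ((2 * (R + 1)) ^ k)⁻¹) := by gcongr
      _ = Real.exp (2 * A) * (R ^ k * ((2 * (R + 1)) ^ k)⁻¹) := by ring
      _ ≤ _ := mul_le_mul_of_nonneg_left (geom_bound hR0 k) (Real.exp_pos _).le
  exact h.differentiableAt (Metric.isOpen_ball.mem_nhds (by simp [hR]))

open Filter Topology in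
lemma ml_norm_le_one {a : ℝ} (h0 : 0 < a) (h1 : a < 1) {z : ℂ} (hz : z.re ≤ 0) :
    ‖mittagLefflerC a z‖ ≤ 1 := by
  obtain ⟨A, hA, hAk⟩ := exists_A h0 (norm_nonneg z)
  have hgen : ∀ (m n : ℕ), A < n → ∀ k : ℕ,
      ‖z ^ k * ((pc m (a * k + 1) * (n : ℝ) ^ (-(a * k)) : ℝ) : ℂ)‖
        ≤ ((1 - A / n) ^ m)⁻¹ * (1 / 2) ^ k := by
    intro m n hn k
    have hn' : (0 : ℝ) < n := hA.trans hn
    have hx : 0 ≤ a * k := by positivity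
    have hs := pc_scaled hA hx m n hn
    rw [hAk] at hs
    have hr : 0 < 1 - A / n := by rw [sub_pos, div_lt_one hn']; exact hn
    have hp : 0 ≤ pc m (a * k + 1) * (n : ℝ) ^ (-(a * k)) :=
      mul_nonneg (pc_nonneg _ (by linarith)) (by positivity)
    rw [norm_mul, norm_pow, Complex.norm_real, Real.norm_of_nonneg hp]
    calc _ ≤ ‖z‖ ^ k * (((1 - A / n) ^ m)⁻¹ * ((2 * (‖z‖ + 1)) ^ k)⁻¹) := by gcongr
      _ = ((1 - A / n) ^ m)⁻¹ * (‖z‖ ^ k * ((2 * (‖z‖ + 1)) ^ k)⁻¹) := by ring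
      _ ≤ _ := mul_le_mul_of_nonneg_left (geom_bound (norm_nonneg z) k) (by positivity)
  have hbd : ∀ n : ℕ, A < n →
      ‖∑' k : ℕ, z ^ k * ((pc n (a * k + 1) * (n : ℝ) ^ (-(a * k)) : ℝ) : ℂ)‖ ≤ 1 := by
    intro n hn
    have hn' : (0 : ℝ) < n := hA.trans hn
    have e : ∀ m k : ℕ, z ^ k * ((pc m (a * k + 1) * (n : ℝ) ^ (-(a * k)) : ℝ) : ℂ)
        = (z * (((n : ℝ) ^ (-a) : ℝ) : ℂ)) ^ k * (pc m (a * k + 1) : ℂ) := by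
      intro m k
      rw [← neg_mul, Real.rpow_mul hn'.le, Real.rpow_natCast]
      push_cast
      rw [mul_pow]
      ring
    simp only [e]
    refine scheme_bound h0 h1 ?_ (fun m => ?_) n
    · rw [Complex.re_mul_ofReal]
      exact mul_nonpos_of_nonpos_of_nonneg hz (by positivity)
    · simp only [← e]
      exact Summable.of_norm_bounded (geom_summable _) (hgen m n hn)
  have hlim : Tendsto (fun n : ℕ => ∑' k : ℕ, z ^ k *
      ((pc n (a * k + 1) * (n : ℝ) ^ (-(a * k)) : ℝ) : ℂ)) atTop (𝓝 (mittagLefflerC a z)) := by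
    unfold mittagLefflerC
    simp only [term_eq]
    refine tendsto_tsum_of_dominated_convergence (geom_summable (Real.exp (2 * A)))
      (fun k => ?_) ?_
    · have hx : 0 ≤ a * k := by positivity
      exact ((Complex.continuous_ofReal.tendsto _).comp (pc_tendsto hx)).const_mul _
    · filter_upwards [eventually_ge_atTop ⌈2 * A⌉₊] with n hn k
      have hn2 : 2 * A ≤ n := Nat.ceil_le.1 hn
      refine (hgen n n (by linarith) k).trans ?_
      exact mul_le_mul_of_nonneg_right (exp_bound hA n hn2) (by positivity)
  refine le_of_tendsto hlim.norm ?_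
  filter_upwards [eventually_ge_atTop ⌈2 * A⌉₊] with n hn
  have hn2 : 2 * A ≤ n := Nat.ceil_le.1 hn
  exact hbd n (by linarith)

lemma ml_second_deriv {a φ : ℝ} (h0 : 0 < a) (h1 : a < 1) (hφ0 : 0 < φ) (hφ1 : φ < Real.pi / 2) :
    ∃ C : ℝ, 0 ≤ C ∧ ∀ w : ℂ, w ≠ 0 → |Complex.arg (-w)| ≤ φ →
      ‖deriv (deriv (mittagLefflerC a)) w‖ ≤ C := by
  have hd := ml_differentiable h0
  have hd1 : Differentiable ℂ (deriv (mittagLefflerC a)) := hd.deriv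
  have hd2 : Differentiable ℂ (deriv (deriv (mittagLefflerC a))) := hd1.deriv
  obtain ⟨C, hC⟩ := (isCompact_closedBall (0 : ℂ) 1).exists_bound_of_continuousOn
    hd2.continuous.continuousOn
  have hcos : 0 < Real.cos φ := Real.cos_pos_of_mem_Ioo ⟨by linarith, hφ1⟩
  refine ⟨max C (2 / Real.cos φ ^ 2), le_max_of_le_right (by positivity), fun w hw harg => ?_⟩
  by_cases hw1 : ‖w‖ ≤ 1
  · exact (hC w (by simpa using hw1)).trans (le_max_left _ _)
  · push Not at hw1
    refine le_trans ?_ (le_max_right _ _)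
    have hre : Real.cos φ * ‖w‖ ≤ -w.re := by
      have hc : Real.cos φ ≤ Real.cos (Complex.arg (-w)) := by
        rw [← Real.cos_abs (Complex.arg (-w))]
        exact Real.cos_le_cos_of_nonneg_of_le_pi (abs_nonneg _) (by linarith) harg
      rw [Complex.cos_arg (neg_ne_zero.2 hw), norm_neg, Complex.neg_re,
        le_div_iff₀ (by positivity)] at hc
      exact hc
    have hR : 0 < Real.cos φ * ‖w‖ := by positivity
    have h := Complex.norm_iteratedDeriv_le_of_forall_mem_sphere_norm_le (C := 1) 2 hR
      (hd.diffContOnCl (s := Metric.ball w (Real.cos φ * ‖w‖))) (fun z hz => by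
        refine ml_norm_le_one h0 h1 ?_
        have h2 := Complex.re_le_norm (z - w)
        rw [mem_sphere_iff_norm.1 hz, Complex.sub_re] at h2
        linarith)
    rw [iteratedDeriv_succ, iteratedDeriv_one] at h
    refine h.trans ?_
    rw [mul_pow]
    have : 1 ≤ ‖w‖ ^ 2 := by nlinarith
    simp only [Nat.factorial_two, Nat.cast_ofNat, mul_one]
    gcongr
    exact le_mul_of_one_le_right (by positivity) this

theorem g_lipschitz_in_s_alpha (α φ₀ : ℝ) (h0 : 0 < α) (h1 : α < 1)
    (hφ0 : 0 < φ₀) (hφ1 : φ₀ < Real.pi / 2) :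
    ∃ C : ℝ, ∀ (lam : ℂ), lam ≠ 0 → |Complex.arg (-lam)| ≤ φ₀ →
      ∀ (T : ℝ), 0 < T → ∀ s s' : ℝ, 0 < s → s ≤ T → 0 < s' → s' ≤ T →
        ‖(α : ℂ) * lam * deriv (mittagLefflerC α) (lam * (s ^ α : ℝ)) -
            (α : ℂ) * lam * deriv (mittagLefflerC α) (lam * (s' ^ α : ℝ))‖ ≤
          C * ‖lam‖ ^ 2 * |s ^ α - s' ^ α| := by
  obtain ⟨C, hC0, hC⟩ := ml_second_deriv h0 h1 hφ0 hφ1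
  refine ⟨α * C, fun lam hlam harg T hT s s' hs _ hs' _ => ?_⟩
  have hd1 : Differentiable ℂ (deriv (mittagLefflerC α)) := (ml_differentiable h0).deriv
  set S : Set ℂ := (fun t : ℝ => t • lam) '' Set.Ioi 0 with hS
  have hconv : Convex ℝ S :=
    (convex_Ioi (0 : ℝ)).is_linear_image (IsLinearMap.mk (fun x y => add_smul x y lam)
      (fun c x => by simp [mul_assoc]))
  have hmem : ∀ t : ℝ, 0 < t → lam * (t : ℂ) ∈ S := fun t ht =>
    ⟨t, ht, by simp [mul_comm]⟩
  have hb : ∀ w ∈ S, ‖deriv (deriv (mittagLefflerC α)) w‖ ≤ C := by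
    rintro w ⟨t, ht, rfl⟩
    have ht' : 0 < t := ht
    refine hC _ (smul_ne_zero ht'.ne' hlam) ?_
    rw [← smul_neg, Complex.real_smul, Complex.arg_real_mul _ ht']
    exact harg
  have h := hconv.norm_image_sub_le_of_norm_deriv_le (𝕜 := ℂ) (fun x _ => hd1 x) hb
    (hmem (s' ^ α) (by positivity)) (hmem (s ^ α) (by positivity))
  rw [← mul_sub, norm_mul lam, ← Complex.ofReal_sub, Complex.norm_real,
    Real.norm_eq_abs] at h
  rw [← mul_sub, norm_mul, norm_mul, Complex.norm_real, Real.norm_of_nonneg h0.le]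
  calc _ ≤ α * ‖lam‖ * (C * (‖lam‖ * |s ^ α - s' ^ α|)) := by gcongr
    _ = _ := by ring
end
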